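/- Let α ∈ (0,1) be irrational and badly approximable, i.e. sup_{i≥1} a_i(α) < ∞. For k ≥ 1 and ε ∈ ℝ define h_{n,k}(α, ε) = | (1 − λ_k ({n ᾱ_k} − 1/2)/n)² − (ε + λ_k/2)²/n² | and H_k(α, ε) = 2π |ε + λ_k| ∏_{n=1}^{⌊q_k/2⌋} h_{n,k}(α, ε). Then |P_{q_k}(α, ε) − H_k(α, ε)| → 0 as k → ∞, and the convergence is locally uniform in ε, i.e. for every compact set K ⊂ ℝ, sup_{ε ∈ K} |P_{q_k}(α, ε) − H_k(α, ε)| → 0. -/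

import Mathlib

/-- The Gauss map `x ↦ {1/x}`. -/
noncomputable def gaussMap (x : ℝ) : ℝ := Int.fract x⁻¹

/-- `pq α i` is the `i`-th partial quotient `aᵢ` of the continued fraction
expansion `α = [0; a₁, a₂, …]` of an irrational `α ∈ (0,1)` (meaningful for `i ≥ 1`). -/
noncomputable def pq (α : ℝ) (i : ℕ) : ℕ := ⌊(gaussMap^[i - 1] α)⁻¹⌋₊

/-- `qden α k` is the denominator `q_k` of the `k`-th convergent of `α`:
`q₀ = 1`, `q₁ = a₁`, `q_{k+2} = a_{k+2} q_{k+1} + q_k`. -/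
noncomputable def qden (α : ℝ) : ℕ → ℕ
  | 0 => 1
  | 1 => pq α 1
  | (k + 2) => pq α (k + 2) * qden α (k + 1) + qden α k

/-- Distance to the nearest integer. -/
noncomputable def nint (x : ℝ) : ℝ := |x - round x|

/-- `δ_k = ‖q_k α‖`. -/
noncomputable def dlt (α : ℝ) (k : ℕ) : ℝ := nint (qden α k * α)

/-- The perturbed Sudler product
`P_{q_k}(α, ε) = ∏_{r=1}^{q_k} 2|sin(π(rα + (-1)^k ε/q_k))|`. -/
noncomputable def sudlerPert (α : ℝ) (k : ℕ) (ε : ℝ) : ℝ :=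
  ∏ r ∈ Finset.Icc 1 (qden α k),
    2 * |Real.sin (Real.pi * (r * α + (-1 : ℝ) ^ k * ε / qden α k))|

/-- `h_{n,k}(α,ε) = |(1 - λ_k({n ᾱ_k} - 1/2)/n)² - (ε + λ_k/2)²/n²|`,
where `λ_k = q_k δ_k` and `ᾱ_k = q_{k-1}/q_k`. -/
noncomputable def hnk (α : ℝ) (k n : ℕ) (ε : ℝ) : ℝ :=
  |(1 - (qden α k * dlt α k) *
        (Int.fract ((n : ℝ) * ((qden α (k - 1) : ℝ) / qden α k)) - 1 / 2) / n) ^ 2 -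
    (ε + (qden α k * dlt α k) / 2) ^ 2 / (n : ℝ) ^ 2|

/-- `H_k(α,ε) = 2π|ε + λ_k| ∏_{n=1}^{⌊q_k/2⌋} h_{n,k}(α,ε)`. -/
noncomputable def HkF (α : ℝ) (k : ℕ) (ε : ℝ) : ℝ :=
  2 * Real.pi * |ε + qden α k * dlt α k| * ∏ n ∈ Finset.Icc 1 (qden α k / 2), hnk α k n ε

/-- The logarithm of the normalized sinc function. -/
noncomputable def logSinc (x : ℝ) : ℝ := Real.log (Real.sinc (Real.pi * x))

lemma analyticAt_sinc (x : ℝ) : AnalyticAt ℝ Real.sinc x := by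
  rcases eq_or_ne x 0 with rfl | hx
  · obtain ⟨p, hp⟩ := Real.analyticAt_sin (x := 0)
    rw [Real.sinc_eq_dslope]
    exact hp.has_fpower_series_dslope_fslope.analyticAt
  · have h : AnalyticAt ℝ (fun y => Real.sin y / y) x :=
      Real.analyticAt_sin.div analyticAt_id hx
    refine h.congr ?_
    filter_upwards [isOpen_ne.mem_nhds hx] with y hy
    exact (Real.sinc_of_ne_zero hy).symm

lemma sinc_pi_mul_pos {x : ℝ} (hx : |x| < 1) : 0 < Real.sinc (Real.pi * x) := by
  have key : ∀ y : ℝ, 0 < y → y < 1 → 0 < Real.sinc (Real.pi * y) := fun y hy hy1 => by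
    have hpy : 0 < Real.pi * y := by positivity
    rw [Real.sinc_of_ne_zero hpy.ne']
    exact div_pos (Real.sin_pos_of_pos_of_lt_pi hpy (by nlinarith [Real.pi_pos])) hpy
  rcases lt_trichotomy x 0 with h | rfl | h
  · have := key (-x) (by linarith) (by rwa [abs_of_neg h] at hx)
    rwa [mul_neg, Real.sinc_neg] at this
  · simp
  · exact key x h (by rwa [abs_of_pos h] at hx)

lemma abs_sin_pi_mul {x : ℝ} (hx : |x| < 1) :
    |Real.sin (Real.pi * x)| = Real.pi * |x| * Real.exp (logSinc x) := by
  rw [logSinc, Real.exp_log (sinc_pi_mul_pos hx)]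
  rcases eq_or_ne x 0 with rfl | h0
  · simp
  · have h : Real.sin (Real.pi * x) = (Real.pi * x) * Real.sinc (Real.pi * x) := by
      have : Real.pi * x ≠ 0 := mul_ne_zero Real.pi_ne_zero h0
      rw [Real.sinc_of_ne_zero this]
      field_simp
    rw [h, abs_mul, abs_mul, abs_of_pos Real.pi_pos, abs_of_pos (sinc_pi_mul_pos hx)]

lemma analyticAt_logSinc {x : ℝ} (hx : |x| < 1) : AnalyticAt ℝ logSinc x := by
  refine AnalyticAt.log ?_ (sinc_pi_mul_pos hx)
  exact (analyticAt_sinc _).comp (f := fun y => Real.pi * y) (analyticAt_const.mul analyticAt_id)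

lemma exists_logSinc_bounds : ∃ M : ℝ, 0 ≤ M ∧
    ∀ x ∈ Set.Icc (-(3 / 4) : ℝ) (3 / 4), ∀ y ∈ Set.Icc (-(3 / 4) : ℝ) (3 / 4),
      |deriv logSinc x| ≤ M ∧ |deriv logSinc y - deriv logSinc x| ≤ M * |y - x| ∧
      |logSinc y - logSinc x| ≤ M * |y - x| ∧
      |logSinc y - logSinc x - deriv logSinc x * (y - x)| ≤ M * (y - x) ^ 2 := by
  have han : ∀ x ∈ Set.Icc (-(3 / 4) : ℝ) (3 / 4), AnalyticAt ℝ logSinc x := fun x hx =>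
    analyticAt_logSinc (by rw [abs_lt]; constructor <;> linarith [hx.1, hx.2])
  obtain ⟨M₁, h₁⟩ := isCompact_Icc.exists_bound_of_continuousOn
    (fun x hx => (han x hx).deriv.continuousAt.continuousWithinAt)
  obtain ⟨M₂, h₂⟩ := isCompact_Icc.exists_bound_of_continuousOn
    (fun x hx => (han x hx).deriv.deriv.continuousAt.continuousWithinAt)
  refine ⟨max 0 (max M₁ M₂), le_max_left _ _, ?_⟩
  set M := max 0 (max M₁ M₂)
  have hM₁ : M₁ ≤ M := (le_max_left _ _).trans (le_max_right _ _)
  have hM₂ : M₂ ≤ M := (le_max_right _ _).trans (le_max_right _ _)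
  have hlip : ∀ x ∈ Set.Icc (-(3 / 4) : ℝ) (3 / 4), ∀ y ∈ Set.Icc (-(3 / 4) : ℝ) (3 / 4),
      |deriv logSinc y - deriv logSinc x| ≤ M * |y - x| := fun x hx y hy =>
    Convex.norm_image_sub_le_of_norm_deriv_le (fun z hz => (han z hz).deriv.differentiableAt)
      (fun z hz => (h₂ z hz).trans hM₂) (convex_Icc _ _) hx hy
  intro x hx y hy
  refine ⟨(h₁ x hx).trans hM₁, hlip x hx y hy,
    Convex.norm_image_sub_le_of_norm_deriv_le (fun z hz => (han z hz).differentiableAt)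
      (fun z hz => (h₁ z hz).trans hM₁) (convex_Icc _ _) hx hy, ?_⟩
  have hsub : Set.uIcc x y ⊆ Set.Icc (-(3 / 4) : ℝ) (3 / 4) := Set.uIcc_subset_Icc hx hy
  have hd : ∀ z ∈ Set.uIcc x y, HasDerivAt (fun w => logSinc w - deriv logSinc x * w)
      (deriv logSinc z - deriv logSinc x) z := fun z hz => by
    have := (han z (hsub hz)).differentiableAt.hasDerivAt.sub
      ((hasDerivAt_id z).const_mul (deriv logSinc x))
    rw [mul_one] at this
    exact this
  have := Convex.norm_image_sub_le_of_norm_deriv_le (C := M * |y - x|)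
    (fun z hz => (hd z hz).differentiableAt)
    (fun z hz => by
      rw [(hd z hz).deriv]
      refine (hlip x hx z (hsub hz)).trans ?_
      refine mul_le_mul_of_nonneg_left ?_ (le_max_left _ _)
      have := Set.abs_sub_left_of_mem_uIcc hz
      rwa [abs_sub_comm y x, abs_sub_comm x y] ) (convex_uIcc x y) Set.left_mem_uIcc
    Set.right_mem_uIcc
  rw [Real.norm_eq_abs, Real.norm_eq_abs, mul_assoc, abs_mul_abs_self] at this
  convert this using 2 <;> ring

lemma prod_two_mul_sin (m : ℕ) :
    ∏ n ∈ Finset.range m, 2 * Real.sin (Real.pi * ((n + 1 : ℕ) / (m + 1 : ℕ))) = m + 1 := by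
  have hζ := Complex.isPrimitiveRoot_exp (m + 1) (Nat.succ_ne_zero m)
  have h := congrArg norm hζ.prod_one_sub_pow_eq_order
  rw [norm_prod] at h
  have hR : ‖((m : ℂ) + 1)‖ = (m : ℝ) + 1 := by
    exact_mod_cast Complex.norm_natCast (m + 1)
  rw [hR] at h
  rw [← h]
  refine Finset.prod_congr rfl fun n hn => ?_
  have hn' : n < m := Finset.mem_range.mp hn
  have hle : ((n + 1 : ℕ) : ℝ) / (m + 1 : ℕ) ≤ 1 := by
    rw [div_le_one (by positivity)]
    exact_mod_cast (by omega : n + 1 ≤ m + 1)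
  have hsin : 0 ≤ Real.sin (Real.pi * ((n + 1 : ℕ) / (m + 1 : ℕ))) :=
    Real.sin_nonneg_of_nonneg_of_le_pi (by positivity) (by nlinarith [Real.pi_pos])
  have he : Complex.exp (2 * Real.pi * Complex.I / ((m + 1 : ℕ) : ℂ)) ^ (n + 1) =
      Complex.exp (Complex.I * ((2 * (Real.pi * ((n + 1 : ℕ) / (m + 1 : ℕ))) : ℝ) : ℂ)) := by
    rw [← Complex.exp_nat_mul]
    congr 1
    push_cast
    ring
  rw [he, norm_sub_rev, Complex.norm_exp_I_mul_ofReal_sub_one, mul_div_cancel_left₀ _ two_ne_zero,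
    Real.norm_eq_abs, abs_of_nonneg (by positivity)]

lemma sum_range_affine_emod {E : Type*} [AddCommMonoid E] (G : ℕ → E) {s : ℕ} (hs : 0 < s) {a : ℤ}
    (ha : IsCoprime a s) (t : ℤ) :
    ∑ i ∈ Finset.range s, G (((i : ℤ) * a + t) % s).toNat = ∑ m ∈ Finset.range s, G m := by
  have hs' : (0 : ℤ) < s := by exact_mod_cast hs
  have hmaps : Set.MapsTo (fun i : ℕ => (((i : ℤ) * a + t) % s).toNat)
      (Finset.range s) (Finset.range s) := fun i _ => by
    simp only [Finset.coe_range, Set.mem_Iio]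
    have := Int.emod_lt_of_pos ((i : ℤ) * a + t) hs'
    omega
  have hinj : Set.InjOn (fun i : ℕ => (((i : ℤ) * a + t) % s).toNat) (Finset.range s) := by
    intro i hi j hj hij
    simp only [Finset.coe_range, Set.mem_Iio] at hi hj hij
    have h1 := Int.emod_nonneg ((i : ℤ) * a + t) hs'.ne'
    have h2 := Int.emod_nonneg ((j : ℤ) * a + t) hs'.ne'
    have h3 : ((i : ℤ) * a + t) % s = ((j : ℤ) * a + t) % s := by omega
    have h4 : (s : ℤ) ∣ ((j : ℤ) - i) * a := by
      have := Int.ModEq.dvd h3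
      convert this using 1
      ring
    have h5 : (s : ℤ) ∣ (j : ℤ) - i := ha.symm.dvd_of_dvd_mul_right h4
    have h6 := Int.eq_zero_of_abs_lt_dvd h5 (by rw [abs_lt]; constructor <;> omega)
    omega
  exact Finset.sum_nbij (fun i : ℕ => (((i : ℤ) * a + t) % s).toNat) (fun i hi => hmaps hi) hinj
    (Finset.surjOn_of_injOn_of_card_le _ hmaps hinj le_rfl) (fun _ _ => rfl)

lemma abs_fract_sub_le {s m : ℕ} (hm : m < s) {φ e : ℝ} (hφ₀ : 0 ≤ φ) (hφ₁ : φ < 1)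
    (he : |e| ≤ 1 / s) :
    |Int.fract ((m + φ) / s + e) - (m + φ) / s| ≤
      1 / s + ((if m = 0 then 1 else 0) + if m + 1 = s then 1 else 0) := by
  have hs : (0 : ℝ) < s := by exact_mod_cast (by omega : 0 < s)
  have hms : (m : ℝ) + 1 ≤ s := by exact_mod_cast hm
  obtain ⟨he₁, he₂⟩ := abs_le.mp he
  have hinv : (0 : ℝ) < 1 / s := by positivity
  by_cases hgood : 1 ≤ m ∧ m + 1 < s
  · have h1 : (1 : ℝ) ≤ m := by exact_mod_cast hgood.1
    have h2 : (m : ℝ) + 2 ≤ s := by exact_mod_cast hgood.2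
    have h3 : 1 / (s : ℝ) ≤ (m + φ) / s := by gcongr; linarith
    have h4 : (m + φ) / s < 1 - 1 / s := by
      rw [lt_sub_iff_add_lt, ← add_div, div_lt_one hs]
      linarith
    have hf : Int.fract ((m + φ) / s + e) = (m + φ) / s + e :=
      Int.fract_eq_self.mpr ⟨by linarith, by linarith⟩
    rw [hf, add_sub_cancel_left]
    refine he.trans (le_add_of_nonneg_right ?_)
    positivity
  · have h1 : (1 : ℝ) ≤ (if m = 0 then 1 else 0) + if m + 1 = s then 1 else 0 := by
      rcases (by omega : m = 0 ∨ m + 1 = s) with h | h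
      · rw [if_pos h]
        exact le_add_of_nonneg_right (by positivity)
      · rw [if_pos h]
        exact le_add_of_nonneg_left (by positivity)
    have h2 : 0 ≤ (m + φ) / s := by positivity
    have h3 : (m + φ) / s < 1 := by
      rw [div_lt_one hs]
      linarith
    have h4 := Int.fract_nonneg ((m + φ) / s + e)
    have h5 := Int.fract_lt_one ((m + φ) / s + e)
    rw [abs_le]
    constructor <;> linarith

lemma abs_sum_fract_block_le {β : ℝ} {s : ℕ} (hs : 0 < s) {a : ℤ} (ha : IsCoprime a s)
    (hβ : |β - a / s| ≤ 1 / (s : ℝ) ^ 2) (θ : ℝ) :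
    |∑ i ∈ Finset.range s, (Int.fract (i * β + θ) - 1 / 2)| ≤ 4 := by
  have hs' : (0 : ℝ) < s := by exact_mod_cast hs
  have hsz : (0 : ℤ) < s := by exact_mod_cast hs
  set t := ⌊s * θ⌋ with ht
  set φ := Int.fract (s * θ) with hφ
  have hθ : (s : ℝ) * θ = t + φ := (Int.floor_add_fract _).symm
  have hφ₀ : 0 ≤ φ := Int.fract_nonneg _
  have hφ₁ : φ < 1 := Int.fract_lt_one _
  let bad : ℕ → ℝ := fun m => (if m = 0 then 1 else 0) + if m + 1 = s then 1 else 0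
  have hpt : ∀ i ∈ Finset.range s,
      |Int.fract (i * β + θ) - 1 / 2 -
        (((((i : ℤ) * a + t) % s).toNat + φ) / s - 1 / 2)| ≤
      1 / s + bad (((i : ℤ) * a + t) % s).toNat := by
    intro i hi
    have his : (i : ℝ) < s := by exact_mod_cast Finset.mem_range.mp hi
    have hm0 := Int.emod_nonneg ((i : ℤ) * a + t) hsz.ne'
    have hm1 := Int.emod_lt_of_pos ((i : ℤ) * a + t) hsz
    set m := (((i : ℤ) * a + t) % s).toNat with hm
    have hmz : (m : ℤ) = ((i : ℤ) * a + t) % s := by omega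
    have hdec : ((i : ℝ) * a + t) = s * ((((i : ℤ) * a + t) / s : ℤ) : ℝ) + m := by
      have := Int.mul_ediv_add_emod ((i : ℤ) * a + t) s
      rw [← hmz] at this
      exact_mod_cast this.symm
    have hx : (i : ℝ) * β + θ = ((m + φ) / s + i * (β - a / s)) +
        ((((i : ℤ) * a + t) / s : ℤ) : ℝ) := by
      have h1 : θ = (t + φ) / s := by rw [← hθ]; field_simp
      have h2 : ((((i : ℤ) * a + t) / s : ℤ) : ℝ) = ((i : ℝ) * a + t - m) / s := by
        rw [hdec]; field_simp; ring
      rw [h1, h2]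
      field_simp
      ring
    rw [hx, Int.fract_add_intCast, sub_sub_sub_cancel_right]
    refine abs_fract_sub_le (by omega) hφ₀ hφ₁ ?_
    rw [abs_mul, abs_of_nonneg (by positivity : (0 : ℝ) ≤ i)]
    calc (i : ℝ) * |β - a / s| ≤ s * (1 / (s : ℝ) ^ 2) := by gcongr
      _ = 1 / s := by field_simp
  have hsum := (Finset.abs_sum_le_sum_abs _ _).trans (Finset.sum_le_sum hpt)
  rw [Finset.sum_sub_distrib, Finset.sum_add_distrib, sum_range_affine_emod bad hs ha t,
    sum_range_affine_emod (fun m => ((m : ℝ) + φ) / s - 1 / 2) hs ha t] at hsum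
  have hbad : ∑ m ∈ Finset.range s, bad m ≤ 2 := by
    simp only [bad, Finset.sum_add_distrib]
    have h1 : ∑ m ∈ Finset.range s, (if m = 0 then (1 : ℝ) else 0) ≤ 1 := by
      rw [Finset.sum_ite_eq']
      split_ifs <;> norm_num
    have h2 : ∑ m ∈ Finset.range s, (if m + 1 = s then (1 : ℝ) else 0) ≤ 1 := by
      have : ∀ m ∈ Finset.range s, (if m + 1 = s then (1 : ℝ) else 0) =
          if m = s - 1 then 1 else 0 := fun m _ => by
        congr 1
        exact propext (by omega)
      rw [Finset.sum_congr rfl this, Finset.sum_ite_eq']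
      split_ifs <;> norm_num
    linarith
  have hconst : ∑ _i ∈ Finset.range s, 1 / (s : ℝ) = 1 := by
    rw [Finset.sum_const, Finset.card_range, nsmul_eq_mul]
    field_simp
  have hid : ∑ m ∈ Finset.range s, (((m : ℝ) + φ) / s - 1 / 2) = φ - 1 / 2 := by
    have hg : ∑ m ∈ Finset.range s, (m : ℝ) = s * (s - 1) / 2 := by
      clear_value t φ
      clear hsum hbad hconst hpt bad hθ ht hφ hβ ha hs hs' hsz
      induction s with
      | zero => simp
      | succ n ih => rw [Finset.sum_range_succ, ih]; push_cast; ring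
    rw [Finset.sum_sub_distrib, ← Finset.sum_div, Finset.sum_add_distrib, hg]
    simp only [Finset.sum_const, Finset.card_range, nsmul_eq_mul]
    field_simp
    ring
  rw [hid, hconst] at hsum
  rw [abs_le] at hsum ⊢
  constructor <;> linarith [hsum.1, hsum.2]

lemma abs_sum_fract_le {β : ℝ} {s : ℕ} (hs : 0 < s) {a : ℤ} (ha : IsCoprime a s)
    (hβ : |β - a / s| ≤ 1 / (s : ℝ) ^ 2) (N : ℕ) : ∀ θ : ℝ,
    |∑ i ∈ Finset.range N, (Int.fract (i * β + θ) - 1 / 2)| ≤ 4 * N / s + s := by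
  have hs' : (0 : ℝ) < s := by exact_mod_cast hs
  induction N using Nat.strong_induction_on with
  | _ N ih =>
    intro θ
    rcases lt_or_ge N s with h | h
    · have h1 : |∑ i ∈ Finset.range N, (Int.fract (i * β + θ) - 1 / 2)| ≤
          ∑ _i ∈ Finset.range N, (1 : ℝ) := by
        refine (Finset.abs_sum_le_sum_abs _ _).trans (Finset.sum_le_sum fun i _ => ?_)
        rw [abs_le]
        constructor <;>
          linarith [Int.fract_nonneg ((i : ℝ) * β + θ), Int.fract_lt_one ((i : ℝ) * β + θ)]
      have h2 : (N : ℝ) ≤ s := by exact_mod_cast h.le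
      have h3 : 0 ≤ 4 * (N : ℝ) / s := by positivity
      simp only [Finset.sum_const, Finset.card_range, nsmul_eq_mul, mul_one] at h1
      linarith
    · obtain ⟨n, rfl⟩ := Nat.exists_eq_add_of_le h
      rw [Finset.sum_range_add]
      have h1 := abs_sum_fract_block_le hs ha hβ θ
      have h2 := ih n (by omega) (s * β + θ)
      have h3 : ∑ i ∈ Finset.range n, (Int.fract (((s + i : ℕ) : ℝ) * β + θ) - 1 / 2) =
          ∑ i ∈ Finset.range n, (Int.fract (i * β + (s * β + θ)) - 1 / 2) :=
        Finset.sum_congr rfl fun i _ => by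
          congr 2
          push_cast
          ring
      rw [h3]
      refine (abs_add_le _ _).trans ((add_le_add h1 h2).trans (le_of_eq ?_))
      push_cast
      field_simp
      ring

lemma abs_sum_fract_le_sqrt {β c : ℝ} (hc : 0 < c) {q : ℕ}
    (hβ : ∀ s : ℕ, 1 ≤ s → s < q → ∀ j : ℤ, c ≤ s * |s * β - j|) {N : ℕ} (hN : N < q) (θ : ℝ) :
    |∑ i ∈ Finset.range N, (Int.fract (i * β + θ) - 1 / 2)| ≤ (8 / c + 1) * √N := by
  rcases Nat.eq_zero_or_pos N with rfl | hN0
  · simp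
  set M := Nat.sqrt N with hM
  have hM1 : 1 ≤ M := Nat.sqrt_pos.mpr hN0
  have hMN : M ≤ N := Nat.sqrt_le_self N
  obtain ⟨r, hr, hrM⟩ := Real.exists_rat_abs_sub_le_and_den_le β (n := M) (by omega)
  have hd : 0 < r.den := r.pos
  have hd' : (0 : ℝ) < r.den := by exact_mod_cast hd
  have hrM' : (r.den : ℝ) ≤ M := by exact_mod_cast hrM
  have hM1' : (1 : ℝ) ≤ M := by exact_mod_cast hM1
  have hrq : (r : ℝ) = (r.num : ℝ) / r.den := Rat.cast_def r
  rw [hrq] at hr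
  have h1 := hβ r.den hd (by omega) r.num
  have h2 : |(r.den : ℝ) * β - r.num| = r.den * |β - r.num / r.den| := by
    rw [← abs_of_pos hd', ← abs_mul, abs_of_pos hd']
    congr 1
    field_simp
  have h3 : c * (M + 1) ≤ r.den := by
    rw [h2] at h1
    have : (r.den : ℝ) * (r.den * |β - r.num / r.den|) ≤
        r.den * (r.den * (1 / ((M + 1) * r.den))) := by gcongr
    have h4 : (r.den : ℝ) * (r.den * (1 / ((M + 1) * r.den))) = r.den / (M + 1) := by
      field_simp
    rw [h4] at this
    exact (le_div_iff₀ (by positivity)).mp (h1.trans this)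
  have hcop : IsCoprime r.num (r.den : ℤ) := by
    rw [Int.isCoprime_iff_gcd_eq_one, Int.gcd_eq_natAbs]
    exact r.reduced
  have h5 := abs_sum_fract_le hd hcop (hr.trans (by
    rw [sq]
    gcongr
    linarith)) N θ
  have h6 : (N : ℝ) ≤ (M + 1) * (M + 1) := by
    exact_mod_cast (Nat.lt_succ_sqrt N).le
  have h7 : (M : ℝ) ≤ √N := by
    rw [Real.le_sqrt' (by positivity)]
    exact_mod_cast Nat.sqrt_le' N
  calc _ ≤ 4 * (N : ℝ) / r.den + r.den := h5
    _ ≤ 4 * ((M + 1) * (M + 1)) / (c * (M + 1)) + M := by gcongr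
    _ = 4 * (M + 1) / c + M := by field_simp
    _ ≤ 4 * (M + M) / c + M := by gcongr
    _ = (8 / c + 1) * M := by ring
    _ ≤ (8 / c + 1) * √N := by gcongr

lemma sum_range_mul_eq_by_parts (g t : ℕ → ℝ) (N : ℕ) :
    ∑ i ∈ Finset.range N, g i * t i = g N * ∑ i ∈ Finset.range N, t i -
      ∑ i ∈ Finset.range N, (g (i + 1) - g i) * ∑ j ∈ Finset.range (i + 1), t j := by
  induction N with
  | zero => simp
  | succ n ih =>
    rw [Finset.sum_range_succ, ih, Finset.sum_range_succ (n := n) (f := fun i => (g (i + 1) - g i) * _),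
      Finset.sum_range_succ t n]
    ring

lemma abs_sum_mul_le_by_parts {g t : ℕ → ℝ} {N : ℕ} {C : ℝ}
    (ht : ∀ j ≤ N, |∑ i ∈ Finset.range j, t i| ≤ C * √j) :
    |∑ i ∈ Finset.range N, g i * t i| ≤ |g N| * (C * √N) +
      ∑ i ∈ Finset.range N, |g (i + 1) - g i| * (C * √(i + 1 : ℕ)) := by
  rw [sum_range_mul_eq_by_parts]
  refine (abs_sub _ _).trans (add_le_add ?_ ?_)
  · rw [abs_mul]
    exact mul_le_mul_of_nonneg_left (ht N le_rfl) (abs_nonneg _)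
  · refine (Finset.abs_sum_le_sum_abs _ _).trans (Finset.sum_le_sum fun i hi => ?_)
    rw [abs_mul]
    exact mul_le_mul_of_nonneg_left (ht _ (Finset.mem_range.mp hi)) (abs_nonneg _)

lemma abs_sum_div_le {t : ℕ → ℝ} {N : ℕ} {C : ℝ} (hC : 0 ≤ C)
    (ht : ∀ j ≤ N, |∑ i ∈ Finset.range j, t i| ≤ C * √j) :
    |∑ i ∈ Finset.range N, t i / (i + 1 : ℕ)| ≤ 3 * C := by
  have h := abs_sum_mul_le_by_parts (g := fun i => 1 / ((i + 1 : ℕ) : ℝ)) ht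
  have h0 : ∑ i ∈ Finset.range N, 1 / ((i + 1 : ℕ) : ℝ) * t i =
      ∑ i ∈ Finset.range N, t i / (i + 1 : ℕ) := Finset.sum_congr rfl fun i _ => by ring
  rw [h0] at h
  have h1 : |1 / ((N + 1 : ℕ) : ℝ)| * (C * √N) ≤ C := by
    rw [abs_of_nonneg (by positivity), one_div, inv_mul_le_iff₀ (by positivity), mul_comm]
    refine mul_le_mul_of_nonneg_right ?_ hC
    rw [Real.sqrt_le_left (by positivity)]
    push_cast
    nlinarith [(Nat.cast_nonneg N : (0 : ℝ) ≤ N)]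
  have h2 : ∀ i ∈ Finset.range N, |1 / ((i + 1 + 1 : ℕ) : ℝ) - 1 / ((i + 1 : ℕ) : ℝ)| *
      (C * √(i + 1 : ℕ)) ≤ 2 * C * (1 / √(i + 1 : ℕ)) - 2 * C * (1 / √(i + 1 + 1 : ℕ)) := by
    intro i _
    set x := √(i + 1 : ℕ) with hx
    set y := √(i + 1 + 1 : ℕ) with hy
    have hx0 : 0 < x := Real.sqrt_pos.mpr (by positivity)
    have hxy : x ≤ y := Real.sqrt_le_sqrt (by push_cast; linarith)
    have hy0 : 0 < y := hx0.trans_le hxy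
    have hxx : ((i + 1 : ℕ) : ℝ) = x ^ 2 := (Real.sq_sqrt (by positivity)).symm
    have hyy : ((i + 1 + 1 : ℕ) : ℝ) = y ^ 2 := (Real.sq_sqrt (by positivity)).symm
    have hdiff : y ^ 2 - x ^ 2 = 1 := by
      rw [← hxx, ← hyy]
      push_cast
      ring
    rw [hxx, hyy, abs_sub_comm, abs_of_nonneg (sub_nonneg.mpr (by gcongr))]
    have e1 : 1 / x ^ 2 - 1 / y ^ 2 = 1 / (x ^ 2 * y ^ 2) := by
      field_simp
      linarith
    have e2 : 1 / x - 1 / y = 1 / (x * y * (x + y)) := by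
      field_simp
      nlinarith
    calc (1 / x ^ 2 - 1 / y ^ 2) * (C * x) = C * (1 / (x * y * y)) := by
          rw [e1]; field_simp
      _ ≤ C * (2 * (1 / (x * y * (x + y)))) := by
          refine mul_le_mul_of_nonneg_left ?_ hC
          rw [mul_one_div, div_le_div_iff₀ (by positivity) (by positivity)]
          nlinarith [mul_nonneg (mul_pos hx0 hy0).le (sub_nonneg.mpr hxy)]
      _ = 2 * C * (1 / x) - 2 * C * (1 / y) := by rw [← e2]; ring
  have h3 := Finset.sum_le_sum h2
  rw [Finset.sum_range_sub' (fun i : ℕ => 2 * C * (1 / √(i + 1 : ℕ)))] at h3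
  have h4 : 0 ≤ 2 * C * (1 / √(N + 1 : ℕ)) := by positivity
  simp only [zero_add, Nat.cast_one, Real.sqrt_one, div_one, mul_one] at h3
  linarith

lemma abs_sum_mul_le_of_lipschitz {g t : ℕ → ℝ} {N q : ℕ} {C M : ℝ} (hC : 0 ≤ C) (hM : 0 ≤ M)
    (hq : 0 < q) (hN : N ≤ q) (ht : ∀ j ≤ N, |∑ i ∈ Finset.range j, t i| ≤ C * √j)
    (hg : |g N| ≤ M) (hg' : ∀ i < N, |g (i + 1) - g i| ≤ M / q) :
    |∑ i ∈ Finset.range N, g i * t i| ≤ 2 * M * C * √q := by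
  have hq' : (0 : ℝ) < q := by exact_mod_cast hq
  refine (abs_sum_mul_le_by_parts ht).trans ?_
  have h1 : |g N| * (C * √N) ≤ M * (C * √q) := by gcongr
  have h2 : ∑ i ∈ Finset.range N, |g (i + 1) - g i| * (C * √(i + 1 : ℕ)) ≤
      ∑ _i ∈ Finset.range N, M / q * (C * √q) := by
    refine Finset.sum_le_sum fun i hi => ?_
    have hi' := Finset.mem_range.mp hi
    have : ((i + 1 : ℕ) : ℝ) ≤ q := by exact_mod_cast (by omega : i + 1 ≤ q)
    gcongr
    exact hg' i hi'
  rw [Finset.sum_const, Finset.card_range, nsmul_eq_mul] at h2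
  have h3 : (N : ℝ) * (M / q * (C * √q)) ≤ q * (M / q * (C * √q)) := by gcongr
  have h4 : (q : ℝ) * (M / q * (C * √q)) = M * (C * √q) := by field_simp
  linarith

lemma sum_one_div_sq_le (N : ℕ) : ∑ i ∈ Finset.range N, 1 / ((i + 1 : ℕ) : ℝ) ^ 2 ≤ 2 := by
  have h : ∀ i ∈ Finset.range N, 1 / ((i + 1 : ℕ) : ℝ) ^ 2 ≤
      2 / ((i + 1 : ℕ) : ℝ) - 2 / ((i + 1 + 1 : ℕ) : ℝ) := fun i _ => by
    rw [div_sub_div _ _ (by positivity) (by positivity),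
      div_le_div_iff₀ (by positivity) (by positivity)]
    push_cast
    have : (0 : ℝ) ≤ i := by positivity
    nlinarith [mul_nonneg this this]
  have h' := Finset.sum_le_sum h
  rw [Finset.sum_range_sub' (fun i : ℕ => 2 / ((i + 1 : ℕ) : ℝ))] at h'
  have : 0 ≤ 2 / ((N + 1 : ℕ) : ℝ) := by positivity
  simp only [zero_add, Nat.cast_one, div_one] at h'
  linarith

lemma prod_abs_sq_sub_sq_le {t : ℕ → ℝ} {N : ℕ} {C l b : ℝ} (hC : 0 ≤ C) (hl₀ : 0 ≤ l)
    (hl₁ : l ≤ 1) (ht₁ : ∀ i, |t i| ≤ 1 / 2)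
    (ht : ∀ j ≤ N, |∑ i ∈ Finset.range j, t i| ≤ C * √j) :
    ∏ i ∈ Finset.range N, |(1 - l * t i / (i + 1 : ℕ)) ^ 2 - b ^ 2 / ((i + 1 : ℕ) : ℝ) ^ 2| ≤
      Real.exp (6 * C + 2 * (1 / 4 + b ^ 2)) := by
  have hpt : ∀ i ∈ Finset.range N,
      |(1 - l * t i / (i + 1 : ℕ)) ^ 2 - b ^ 2 / ((i + 1 : ℕ) : ℝ) ^ 2| ≤
      Real.exp (-2 * l * (t i / (i + 1 : ℕ)) + (1 / 4 + b ^ 2) * (1 / ((i + 1 : ℕ) : ℝ) ^ 2)) := by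
    intro i _
    refine le_trans ?_ (Real.add_one_le_exp _)
    have h1 : (l * t i) ^ 2 ≤ 1 / 4 := by
      have : |l * t i| ≤ 1 / 2 := by
        rw [abs_mul, abs_of_nonneg hl₀]
        nlinarith [ht₁ i, abs_nonneg (t i)]
      have := (sq_le_sq' (abs_le.mp this).1 (abs_le.mp this).2)
      linarith
    set n : ℝ := ((i + 1 : ℕ) : ℝ) with hn
    have hn0 : 0 < n := by positivity
    have h2 : (1 - l * t i / n) ^ 2 = 1 - 2 * l * (t i / n) + (l * t i) ^ 2 * (1 / n ^ 2) := by
      field_simp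
      ring
    have h3 : (l * t i) ^ 2 * (1 / n ^ 2) ≤ 1 / 4 * (1 / n ^ 2) := by gcongr
    have h4 : b ^ 2 / n ^ 2 = b ^ 2 * (1 / n ^ 2) := by ring
    have h5 : 0 ≤ (1 - l * t i / n) ^ 2 := sq_nonneg _
    have h6 : 0 ≤ b ^ 2 * (1 / n ^ 2) := by positivity
    rw [h4, abs_le]
    constructor <;> nlinarith
  refine (Finset.prod_le_prod (fun _ _ => abs_nonneg _) hpt).trans ?_
  rw [← Real.exp_sum, Real.exp_le_exp, Finset.sum_add_distrib, ← Finset.mul_sum, ← Finset.mul_sum]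
  have h1 := abs_sum_div_le hC ht
  have h2 := sum_one_div_sq_le N
  have h3 : (1 / 4 + b ^ 2) * ∑ i ∈ Finset.range N, 1 / ((i + 1 : ℕ) : ℝ) ^ 2 ≤
      (1 / 4 + b ^ 2) * 2 := mul_le_mul_of_nonneg_left h2 (by positivity)
  have h4 : -2 * l * ∑ i ∈ Finset.range N, t i / (i + 1 : ℕ) ≤ 2 * (3 * C) := by
    have : |-2 * l * ∑ i ∈ Finset.range N, t i / (i + 1 : ℕ)| ≤ 2 * 1 * (3 * C) := by
      rw [abs_mul, abs_mul, abs_of_nonneg hl₀, show |(-2 : ℝ)| = 2 by norm_num]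
      gcongr
    linarith [le_abs_self (-2 * l * ∑ i ∈ Finset.range N, t i / (i + 1 : ℕ))]
  linarith

lemma prod_range_half_mul_reflect (w : ℕ → ℝ) {q : ℕ} (hq : 0 < q) :
    ∏ i ∈ Finset.range (q / 2), w (i + 1) * w (q - (i + 1)) =
      (∏ i ∈ Finset.range (q - 1), w (i + 1)) * if Even q then w (q / 2) else 1 := by
  rw [Finset.prod_mul_distrib]
  rcases Nat.even_or_odd' q with ⟨m, rfl | rfl⟩
  · obtain ⟨n, rfl⟩ := Nat.exists_eq_succ_of_ne_zero (by omega : m ≠ 0)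
    rw [if_pos (even_two_mul _), Nat.mul_div_cancel_left _ two_pos,
      show 2 * n.succ - 1 = (n + 1) + n by omega, Finset.prod_range_add, mul_assoc]
    congr 1
    rw [← Finset.prod_range_reflect, Finset.prod_range_succ']
    congr 1
    · refine Finset.prod_congr rfl fun i hi => ?_
      have := Finset.mem_range.mp hi
      congr 1
      omega
    · congr 1
      omega
  · rw [if_neg (by simp), mul_one, show (2 * m + 1) / 2 = m by omega,
      show 2 * m + 1 - 1 = m + m by omega, Finset.prod_range_add]
    congr 1
    rw [← Finset.prod_range_reflect]
    refine Finset.prod_congr rfl fun i hi => ?_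
    have := Finset.mem_range.mp hi
    congr 1
    omega

/-- The product `∏_{n<q} 2|sin(π(n + l(1 - {nβ}) + ε)/q)|`, which equals the perturbed Sudler
product for `β = q_{k-1}/q_k` and `l = λ_k`. -/
noncomputable def reindexedSudler (q : ℕ) (β l ε : ℝ) : ℝ :=
  ∏ n ∈ Finset.range q, 2 * |Real.sin (Real.pi * ((n + l * (1 - Int.fract (n * β)) + ε) / q))|

/-- The main term `2π|ε + l| ∏_{n ≤ q/2} |(1 - l({nβ} - 1/2)/n)² - (ε + l/2)²/n²|`. -/
noncomputable def rationalMainTerm (q : ℕ) (β l ε : ℝ) : ℝ :=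
  2 * Real.pi * |ε + l| * ∏ i ∈ Finset.range (q / 2),
    |(1 - l * (Int.fract ((i + 1 : ℕ) * β) - 1 / 2) / (i + 1 : ℕ)) ^ 2 -
      (ε + l / 2) ^ 2 / ((i + 1 : ℕ) : ℝ) ^ 2|

/-- The exponent of the ratio between `reindexedSudler` and `rationalMainTerm`. -/
noncomputable def sudlerExponent (q : ℕ) (β l ε : ℝ) : ℝ :=
  logSinc ((ε + l) / q) + ∑ i ∈ Finset.range (q / 2),
    (logSinc (((i + 1 : ℕ) - l * (Int.fract ((i + 1 : ℕ) * β) - 1 / 2) + (ε + l / 2)) / q) +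
      logSinc (((i + 1 : ℕ) - l * (Int.fract ((i + 1 : ℕ) * β) - 1 / 2) - (ε + l / 2)) / q) -
      2 * logSinc ((i + 1 : ℕ) / q))

lemma abs_fract_sub_half_le (x : ℝ) : |Int.fract x - 1 / 2| ≤ 1 / 2 := by
  rw [abs_le]
  constructor <;> linarith [Int.fract_nonneg x, (Int.fract_lt_one x).le]

lemma abs_mul_sub_half_le {l : ℝ} (hl₀ : 0 ≤ l) (hl₁ : l ≤ 1) (x : ℝ) :
    |l * (Int.fract x - 1 / 2)| ≤ 1 / 2 := by
  rw [abs_mul, abs_of_nonneg hl₀]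
  nlinarith [abs_fract_sub_half_le x, abs_nonneg (Int.fract x - 1 / 2)]

lemma add_div_mem_Icc {q : ℕ} {x d R : ℝ} (hq : 4 * (R + 1) ≤ q) (hR : 0 ≤ R) (hx₀ : 0 ≤ x)
    (hx : 2 * x ≤ q) (hd : |d| ≤ R + 1) : (x + d) / q ∈ Set.Icc (-(3 / 4) : ℝ) (3 / 4) := by
  have hq0 : (0 : ℝ) < q := by linarith
  obtain ⟨h1, h2⟩ := abs_le.mp hd
  rw [Set.mem_Icc, le_div_iff₀ hq0, div_le_iff₀ hq0]
  constructor <;> linarith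

lemma abs_lt_one_of_mem_Icc {x : ℝ} (hx : x ∈ Set.Icc (-(3 / 4) : ℝ) (3 / 4)) : |x| < 1 := by
  rw [abs_lt]
  constructor <;> linarith [hx.1, hx.2]

lemma sin_ratio_mul_reflect {q n : ℕ} {A b : ℝ} (hn : 0 < n) (hnq : n < q)
    (h1 : |(A + b) / q| < 1) (h2 : |(A - b) / q| < 1) :
    |Real.sin (Real.pi * ((A + b) / q))| / Real.sin (Real.pi * (n / q)) *
      (|Real.sin (Real.pi * ((A - b) / q))| / Real.sin (Real.pi * (n / q))) =
    |(A / n) ^ 2 - b ^ 2 / (n : ℝ) ^ 2| *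
      Real.exp (logSinc ((A + b) / q) + logSinc ((A - b) / q) - 2 * logSinc (n / q)) := by
  have hn0 : (0 : ℝ) < n := by exact_mod_cast hn
  have hq0 : (0 : ℝ) < q := by exact_mod_cast hn.trans hnq
  have hx0 : (0 : ℝ) < n / q := by positivity
  have hx1 : (n : ℝ) / q < 1 := by
    rw [div_lt_one hq0]
    exact_mod_cast hnq
  have hs : Real.sin (Real.pi * (n / q)) = Real.pi * (n / q) * Real.exp (logSinc (n / q)) := by
    have hpos : 0 < Real.sin (Real.pi * (n / q)) :=
      Real.sin_pos_of_pos_of_lt_pi (by positivity) (by nlinarith [Real.pi_pos])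
    rw [← abs_of_pos hpos, abs_sin_pi_mul (by rwa [abs_of_pos hx0]), abs_of_pos hx0]
  rw [hs, abs_sin_pi_mul h1, abs_sin_pi_mul h2]
  have h3 : (A / n) ^ 2 - b ^ 2 / (n : ℝ) ^ 2 = (A + b) * (A - b) / (n : ℝ) ^ 2 := by
    field_simp
    ring
  rw [h3, abs_div ((A + b) * (A - b)), abs_mul (A + b), abs_of_pos (pow_pos hn0 2), abs_div, abs_div,
    abs_of_pos hq0,
    Real.exp_sub, Real.exp_add, two_mul, Real.exp_add]
  have hpi := Real.pi_pos
  field_simp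

lemma fract_reflect {q : ℕ} {β : ℝ} {p : ℤ} (hβ : q * β = p) {n : ℕ} (hn : n ≤ q)
    (hne : Int.fract (n * β) ≠ 0) : Int.fract ((q - n : ℕ) * β) = 1 - Int.fract (n * β) := by
  rw [Nat.cast_sub hn, sub_mul, hβ, sub_eq_add_neg, Int.fract_intCast_add, Int.fract_neg hne]

lemma reindexedSudler_mul_eq {q : ℕ} {β l ε R : ℝ} {p : ℤ} (hR : 0 ≤ R) (hq : 4 * (R + 1) ≤ q)
    (hβ : q * β = p) (hne : ∀ n : ℕ, 0 < n → n < q → Int.fract (n * β) ≠ 0)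
    (hl₀ : 0 ≤ l) (hl₁ : l ≤ 1) (hε : |ε| ≤ R) :
    reindexedSudler q β l ε * (if Even q then |Real.cos (Real.pi * ((ε + l / 2) / q))| else 1) =
      rationalMainTerm q β l ε * Real.exp (sudlerExponent q β l ε) := by
  have hq0 : (0 : ℝ) < q := by linarith
  have hq4 : 4 ≤ q := by
    have : (4 : ℝ) ≤ q := by linarith
    exact_mod_cast this
  obtain ⟨hε₁, hε₂⟩ := abs_le.mp hε
  set b := ε + l / 2 with hb
  let A : ℕ → ℝ := fun n => n - l * (Int.fract (n * β) - 1 / 2)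
  let u : ℕ → ℝ := fun n => n + l * (1 - Int.fract (n * β)) + ε
  let w : ℕ → ℝ := fun n => |Real.sin (Real.pi * (u n / q))| / Real.sin (Real.pi * (n / q))
  have hu : ∀ n, u n = A n + b := fun n => by simp only [u, A, hb]; ring
  have hrefl : ∀ n, 0 < n → n < q → u (q - n) = q - (A n - b) := fun n h0 h1 => by
    simp only [u, A, hb]
    rw [fract_reflect hβ h1.le (hne n h0 h1), Nat.cast_sub h1.le]
    ring
  have hsin_refl : ∀ x : ℝ, Real.sin (Real.pi * ((q - x) / q)) = Real.sin (Real.pi * (x / q)) :=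
    fun x => by
      rw [sub_div, div_self hq0.ne', mul_sub, mul_one, Real.sin_pi_sub]
  have hmemA : ∀ n : ℕ, 2 * n ≤ q → ∀ d : ℝ, |d| ≤ R + 1 / 2 → |(A n + d) / q| < 1 := by
    intro n hn d hd
    have h1 := abs_mul_sub_half_le hl₀ hl₁ (n * β)
    have h2 : A n + d = n + (d - l * (Int.fract (n * β) - 1 / 2)) := by simp only [A]; ring
    rw [h2]
    refine abs_lt_one_of_mem_Icc (add_div_mem_Icc hq hR (by positivity) (by exact_mod_cast hn) ?_)
    exact (abs_sub _ _).trans (by linarith)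
  have hb' : |b| ≤ R + 1 / 2 := by rw [abs_le, hb]; constructor <;> linarith
  have hw : ∀ i ∈ Finset.range (q / 2), w (i + 1) * w (q - (i + 1)) =
      |(1 - l * (Int.fract ((i + 1 : ℕ) * β) - 1 / 2) / (i + 1 : ℕ)) ^ 2 -
        b ^ 2 / ((i + 1 : ℕ) : ℝ) ^ 2| *
      Real.exp (logSinc (((i + 1 : ℕ) - l * (Int.fract ((i + 1 : ℕ) * β) - 1 / 2) + b) / q) +
        logSinc (((i + 1 : ℕ) - l * (Int.fract ((i + 1 : ℕ) * β) - 1 / 2) - b) / q) -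
        2 * logSinc ((i + 1 : ℕ) / q)) := by
    intro i hi
    have hi' := Finset.mem_range.mp hi
    have hnq : i + 1 < q := by omega
    have h2n : 2 * (i + 1) ≤ q := by omega
    have hn0 : ((i + 1 : ℕ) : ℝ) ≠ 0 := by positivity
    have key := sin_ratio_mul_reflect (A := A (i + 1)) (b := b) (Nat.succ_pos i) hnq
      (hmemA _ h2n b hb') (by rw [sub_eq_add_neg]; exact hmemA _ h2n (-b) (by rwa [abs_neg]))
    have hA : 1 - l * (Int.fract ((i + 1 : ℕ) * β) - 1 / 2) / (i + 1 : ℕ) =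
        A (i + 1) / (i + 1 : ℕ) := by
      simp only [A]
      field_simp
    rw [hA]
    refine Eq.trans ?_ key
    simp only [w]
    rw [hrefl _ (Nat.succ_pos i) hnq, hsin_refl, hu, Nat.cast_sub hnq.le, hsin_refl]
  have hfold := prod_range_half_mul_reflect w (by omega : 0 < q)
  rw [Finset.prod_congr rfl hw, Finset.prod_mul_distrib, ← Real.exp_sum] at hfold
  have heven : (if Even q then w (q / 2) else 1) =
      if Even q then |Real.cos (Real.pi * (b / q))| else 1 := by
    split_ifs with he
    · obtain ⟨m, hm⟩ := he
      have hm2 : q / 2 = m := by omega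
      have hmr : (q : ℝ) = m + m := by exact_mod_cast hm
      have h1 := hrefl m (by omega) (by omega)
      rw [show q - m = m by omega, hu] at h1
      have hAm : A m = m := by linarith
      have h2 : Real.pi * ((m : ℝ) / q) = Real.pi / 2 := by
        rw [hmr] at hq0 ⊢
        have hm0 : (0 : ℝ) < m := by linarith
        field_simp
        norm_num
      simp only [w]
      rw [hm2, hu, hAm, h2, Real.sin_pi_div_two, div_one, add_div, mul_add, h2, add_comm,
        Real.sin_add_pi_div_two]
    · rfl
  have hsplit : reindexedSudler q β l ε =
      2 * |Real.sin (Real.pi * ((ε + l) / q))| * (q * ∏ i ∈ Finset.range (q - 1), w (i + 1)) := by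
    obtain ⟨m, rfl⟩ := Nat.exists_eq_succ_of_ne_zero (by omega : q ≠ 0)
    have hp := prod_two_mul_sin m
    rw [reindexedSudler, Nat.succ_eq_add_one, Finset.prod_range_succ', mul_comm, Nat.add_sub_cancel]
    congr 1
    · simp only [Nat.cast_zero, zero_mul, Int.fract_zero, sub_zero, mul_one, zero_add]
      rw [add_comm l ε]
    · refine Eq.trans ?_ (congrArg (· * _) (hp.trans (Nat.cast_succ m).symm))
      rw [← Finset.prod_mul_distrib]
      refine Finset.prod_congr rfl fun i hi => ?_
      have him := Finset.mem_range.mp hi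
      have hpos : 0 < Real.sin (Real.pi * ((i + 1 : ℕ) / (m + 1 : ℕ))) := by
        have : ((i + 1 : ℕ) : ℝ) / (m + 1 : ℕ) < 1 := by
          rw [div_lt_one (by positivity)]
          exact_mod_cast (by omega : i + 1 < m + 1)
        exact Real.sin_pos_of_pos_of_lt_pi (by positivity) (by nlinarith [Real.pi_pos])
      simp only [w, u, Nat.succ_eq_add_one]
      generalize Real.sin (Real.pi * ((i + 1 : ℕ) / (m + 1 : ℕ))) = S at hpos
      field_simp
  have hfirst : |Real.sin (Real.pi * ((ε + l) / q))| * q =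
      Real.pi * |ε + l| * Real.exp (logSinc ((ε + l) / q)) := by
    have hmem : |(ε + l) / q| < 1 := by
      have := add_div_mem_Icc (d := ε + l) hq hR le_rfl (by linarith)
        (by rw [abs_le]; constructor <;> linarith)
      rw [zero_add] at this
      exact abs_lt_one_of_mem_Icc this
    rw [abs_sin_pi_mul hmem, abs_div, abs_of_pos hq0]
    field_simp
  rw [heven] at hfold
  rw [hsplit, rationalMainTerm, sudlerExponent, Real.exp_add, ← hb]
  calc _ = 2 * (|Real.sin (Real.pi * ((ε + l) / q))| * q) *
        ((∏ i ∈ Finset.range (q - 1), w (i + 1)) *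
          if Even q then |Real.cos (Real.pi * (b / q))| else 1) := by ring
    _ = _ := by
      rw [hfirst, ← hfold]
      ring

lemma abs_sudlerExponent_le {M : ℝ} (hM₀ : 0 ≤ M)
    (hM : ∀ x ∈ Set.Icc (-(3 / 4) : ℝ) (3 / 4), ∀ y ∈ Set.Icc (-(3 / 4) : ℝ) (3 / 4),
      |deriv logSinc x| ≤ M ∧ |deriv logSinc y - deriv logSinc x| ≤ M * |y - x| ∧
      |logSinc y - logSinc x| ≤ M * |y - x| ∧
      |logSinc y - logSinc x - deriv logSinc x * (y - x)| ≤ M * (y - x) ^ 2)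
    {q : ℕ} {β l ε R C : ℝ} (hR : 0 ≤ R) (hC : 0 ≤ C) (hq : 4 * (R + 1) ≤ q)
    (hS : ∀ j : ℕ, j < q →
      |∑ i ∈ Finset.range j, (Int.fract ((i + 1 : ℕ) * β) - 1 / 2)| ≤ C * √j)
    (hl₀ : 0 ≤ l) (hl₁ : l ≤ 1) (hε : |ε| ≤ R) :
    |sudlerExponent q β l ε| ≤ (4 * M * C + 2 * M * (R + 1) ^ 2 + M * (R + 1)) / √q := by
  have hq0 : (0 : ℝ) < q := by linarith
  have hq1 : (1 : ℝ) ≤ q := by linarith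
  have hq4 : 4 ≤ q := by
    have : (4 : ℝ) ≤ q := by linarith
    exact_mod_cast this
  obtain ⟨hε₁, hε₂⟩ := abs_le.mp hε
  have hb : |ε + l / 2| ≤ R + 1 / 2 := by rw [abs_le]; constructor <;> linarith
  have hεl : |ε + l| ≤ R + 1 := by rw [abs_le]; constructor <;> linarith
  have hR1 : |(0 : ℝ)| ≤ R + 1 := by rw [abs_zero]; linarith
  have hsq : √(q : ℝ) * √q = q := Real.mul_self_sqrt hq0.le
  have hsq0 : 0 < √(q : ℝ) := Real.sqrt_pos.mpr hq0
  have hsq1 : √(q : ℝ) ≤ q := by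
    rw [Real.sqrt_le_left hq0.le]
    nlinarith
  have hfirst : |logSinc ((ε + l) / q)| ≤ M * (R + 1) / √q := by
    have h1 := add_div_mem_Icc hq hR le_rfl (by linarith) hεl
    have h0 := add_div_mem_Icc hq hR le_rfl (by linarith) hR1
    have h2 := (hM _ h0 _ h1).2.2.1
    have hL0 : logSinc 0 = 0 := by simp [logSinc]
    simp only [zero_add, zero_div, sub_zero, hL0] at h2
    refine h2.trans ?_
    rw [abs_div, abs_of_pos hq0, mul_div_assoc]
    gcongr
  let t : ℕ → ℝ := fun i => Int.fract ((i + 1 : ℕ) * β) - 1 / 2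
  let g : ℕ → ℝ := fun i => deriv logSinc ((i + 1 : ℕ) / q)
  have hx : ∀ i : ℕ, i < q / 2 → ((i + 1 : ℕ) : ℝ) / q ∈ Set.Icc (-(3 / 4) : ℝ) (3 / 4) := by
    intro i hi
    have h2 : (2 : ℝ) * (i + 1 : ℕ) ≤ q := by exact_mod_cast (by omega : 2 * (i + 1) ≤ q)
    simpa using add_div_mem_Icc hq hR (by positivity) h2 hR1
  have hx' : ((q / 2 + 1 : ℕ) : ℝ) / q ∈ Set.Icc (-(3 / 4) : ℝ) (3 / 4) := by
    have h2 : (2 : ℝ) * (q / 2 : ℕ) ≤ q := by exact_mod_cast (by omega : 2 * (q / 2) ≤ q)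
    have := add_div_mem_Icc (d := 1) hq hR (by positivity) h2 (by rw [abs_one]; linarith)
    exact_mod_cast this
  have hpt : ∀ i ∈ Finset.range (q / 2),
      |(logSinc (((i + 1 : ℕ) - l * t i + (ε + l / 2)) / q) +
        logSinc (((i + 1 : ℕ) - l * t i - (ε + l / 2)) / q) - 2 * logSinc ((i + 1 : ℕ) / q)) +
        2 * l / q * (g i * t i)| ≤ 2 * M * (R + 1) ^ 2 / (q : ℝ) ^ 2 := by
    intro i hi
    have hi' := Finset.mem_range.mp hi
    have h2 : (2 : ℝ) * (i + 1 : ℕ) ≤ q := by exact_mod_cast (by omega : 2 * (i + 1) ≤ q)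
    have hlt : |l * t i| ≤ 1 / 2 := abs_mul_sub_half_le hl₀ hl₁ _
    have key : ∀ d : ℝ, |d| ≤ R + 1 →
        |logSinc (((i + 1 : ℕ) + d) / q) - logSinc ((i + 1 : ℕ) / q) - g i * (d / q)| ≤
          M * (R + 1) ^ 2 / (q : ℝ) ^ 2 := by
      intro d hd
      have h3 := (hM _ (hx i hi') _ (add_div_mem_Icc hq hR (by positivity) h2 hd)).2.2.2
      rw [← sub_div, add_sub_cancel_left] at h3
      refine h3.trans ?_
      rw [div_pow, mul_div_assoc, ← sq_abs d]
      gcongr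
    have k1 := key (-(l * t i) + (ε + l / 2)) ((abs_add_le _ _).trans (by rw [abs_neg]; linarith))
    have k2 := key (-(l * t i) - (ε + l / 2)) ((abs_sub _ _).trans (by rw [abs_neg]; linarith))
    have e1 : ((i + 1 : ℕ) - l * t i + (ε + l / 2)) =
      ((i + 1 : ℕ) : ℝ) + (-(l * t i) + (ε + l / 2)) := by ring
    have e2 : ((i + 1 : ℕ) - l * t i - (ε + l / 2)) =
      ((i + 1 : ℕ) : ℝ) + (-(l * t i) - (ε + l / 2)) := by ring
    rw [e1, e2]
    refine le_trans (le_of_eq ?_) ((abs_add_le _ _).trans ((add_le_add k1 k2).trans (le_of_eq ?_)))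
    · congr 1
      ring
    · ring
  have hsum := (Finset.abs_sum_le_sum_abs _ _).trans (Finset.sum_le_sum hpt)
  rw [Finset.sum_add_distrib, ← Finset.mul_sum, Finset.sum_const, Finset.card_range,
    nsmul_eq_mul] at hsum
  have hquad : ((q / 2 : ℕ) : ℝ) * (2 * M * (R + 1) ^ 2 / (q : ℝ) ^ 2) ≤
      2 * M * (R + 1) ^ 2 / √q := by
    have h1 : ((q / 2 : ℕ) : ℝ) ≤ q := by exact_mod_cast Nat.div_le_self q 2
    calc ((q / 2 : ℕ) : ℝ) * (2 * M * (R + 1) ^ 2 / (q : ℝ) ^ 2)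
        ≤ q * (2 * M * (R + 1) ^ 2 / (q : ℝ) ^ 2) := by gcongr
      _ = 2 * M * (R + 1) ^ 2 / q := by field_simp
      _ ≤ 2 * M * (R + 1) ^ 2 / √q := by gcongr
  have hlin : |2 * l / q * ∑ i ∈ Finset.range (q / 2), g i * t i| ≤ 4 * M * C / √q := by
    have h1 : |∑ i ∈ Finset.range (q / 2), g i * t i| ≤ 2 * M * C * √q := by
      refine abs_sum_mul_le_of_lipschitz hC hM₀ (by omega) (Nat.div_le_self q 2)
        (fun j hj => hS j (by omega)) (hM _ hx' _ hx').1 fun i hi => ?_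
      have hi2 : ((i + 1 + 1 : ℕ) : ℝ) / q ∈ Set.Icc (-(3 / 4) : ℝ) (3 / 4) := by
        rcases (by omega : i + 1 < q / 2 ∨ i + 1 = q / 2) with h | h
        · exact hx _ h
        · rw [h]; exact hx'
      refine (hM _ (hx i hi) _ hi2).2.1.trans (le_of_eq ?_)
      rw [← sub_div, abs_div, abs_of_pos hq0]
      push_cast
      rw [add_sub_cancel_left, abs_one, mul_one_div]
    rw [abs_mul, abs_of_nonneg (by positivity)]
    calc 2 * l / q * |∑ i ∈ Finset.range (q / 2), g i * t i| ≤
          2 * 1 / q * (2 * M * C * √q) := by gcongr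
      _ = 4 * M * C * √q / (√q * √q) := by rw [hsq]; ring
      _ = 4 * M * C / √q := by field_simp
  have hK : (4 * M * C + 2 * M * (R + 1) ^ 2 + M * (R + 1)) / √q =
      4 * M * C / √q + 2 * M * (R + 1) ^ 2 / √q + M * (R + 1) / √q := by ring
  simp only [t] at hsum hlin
  rw [sudlerExponent, hK]
  rw [abs_le] at hfirst hsum hlin ⊢
  constructor <;> linarith [hfirst.1, hfirst.2, hsum.1, hsum.2, hlin.1, hlin.2]

/-- Quantitative comparison of `reindexedSudler` with its main term. -/
lemma exists_abs_reindexedSudler_sub_le {R C : ℝ} (hR : 0 ≤ R) (hC : 0 ≤ C) :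
    ∃ D Q : ℝ, ∀ (q : ℕ) (β l ε : ℝ) (p : ℤ), Q ≤ q → q * β = p →
      (∀ n : ℕ, 0 < n → n < q → Int.fract (n * β) ≠ 0) →
      (∀ j : ℕ, j < q →
        |∑ i ∈ Finset.range j, (Int.fract ((i + 1 : ℕ) * β) - 1 / 2)| ≤ C * √j) →
      0 ≤ l → l ≤ 1 → |ε| ≤ R →
      |reindexedSudler q β l ε - rationalMainTerm q β l ε| ≤ D / √q := by
  obtain ⟨M, hM₀, hM⟩ := exists_logSinc_bounds
  set K := 4 * M * C + 2 * M * (R + 1) ^ 2 + M * (R + 1) with hK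
  set B := 2 * Real.pi * (R + 1) * Real.exp (6 * C + 2 * (1 / 4 + (R + 1) ^ 2)) with hB
  have hK₀ : 0 ≤ K := by positivity
  refine ⟨2 * (B * (2 * K + 2 * (R + 1))), max (4 * (R + 1)) (K ^ 2), ?_⟩
  intro q β l ε p hQ hβ hne hS hl₀ hl₁ hε
  have hq : 4 * (R + 1) ≤ q := (le_max_left _ _).trans hQ
  have hqK : K ^ 2 ≤ q := (le_max_right _ _).trans hQ
  have hq0 : (0 : ℝ) < q := by linarith
  have hsq0 : 0 < √(q : ℝ) := Real.sqrt_pos.mpr hq0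
  have hsq1 : √(q : ℝ) ≤ q := by
    rw [Real.sqrt_le_left hq0.le]
    nlinarith
  obtain ⟨hε₁, hε₂⟩ := abs_le.mp hε
  have hb : |ε + l / 2| ≤ R + 1 := by rw [abs_le]; constructor <;> linarith
  have hεl : |ε + l| ≤ R + 1 := by rw [abs_le]; constructor <;> linarith
  have hid := reindexedSudler_mul_eq hR hq hβ hne hl₀ hl₁ hε
  have hE := abs_sudlerExponent_le hM₀ hM hR hC hq hS hl₀ hl₁ hε
  rw [← hK] at hE
  have hH₀ : 0 ≤ rationalMainTerm q β l ε :=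
    mul_nonneg (by positivity) (Finset.prod_nonneg fun _ _ => abs_nonneg _)
  have hH : rationalMainTerm q β l ε ≤ B := by
    rw [rationalMainTerm, hB]
    have h1 := prod_abs_sq_sub_sq_le (b := ε + l / 2) hC hl₀ hl₁
      (fun i => abs_fract_sub_half_le ((i + 1 : ℕ) * β))
      (fun j (hj : j ≤ q / 2) => hS j (by
        have : (0 : ℕ) < q := by exact_mod_cast hq0
        omega))
    have h2 : (ε + l / 2) ^ 2 ≤ (R + 1) ^ 2 := by
      rw [← sq_abs]
      gcongr
    have h3 : Real.exp (6 * C + 2 * (1 / 4 + (ε + l / 2) ^ 2)) ≤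
        Real.exp (6 * C + 2 * (1 / 4 + (R + 1) ^ 2)) := by gcongr
    exact mul_le_mul (by gcongr) (h1.trans h3) (Finset.prod_nonneg fun _ _ => abs_nonneg _)
      (by positivity)
  set c : ℝ := if Even q then |Real.cos (Real.pi * ((ε + l / 2) / q))| else 1 with hc
  have hx1 : |(ε + l / 2) / q| ≤ (R + 1) / q := by
    rw [abs_div, abs_of_pos hq0]
    gcongr
  have hx2 : (R + 1) / q ≤ 1 / 4 := by
    rw [div_le_div_iff₀ hq0 (by norm_num)]
    linarith
  have hcos : 1 - 2 * ((R + 1) / q) ≤ Real.cos (Real.pi * ((ε + l / 2) / q)) := by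
    refine le_trans ?_ (Real.one_sub_sq_div_two_le_cos)
    have h1 : (Real.pi * ((ε + l / 2) / q)) ^ 2 ≤ 4 ^ 2 * ((R + 1) / q) ^ 2 := by
      rw [mul_pow, ← sq_abs ((ε + l / 2) / q)]
      have := Real.pi_le_four
      gcongr
    have h2 : 0 ≤ (R + 1) / q := by positivity
    nlinarith
  have hc₁ : c ≤ 1 := by
    rw [hc]
    split_ifs
    · exact Real.abs_cos_le_one _
    · exact le_rfl
  have hc₂ : 1 - 2 * ((R + 1) / q) ≤ c := by
    rw [hc]
    split_ifs
    · exact hcos.trans (le_abs_self _)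
    · have : 0 ≤ (R + 1) / q := by positivity
      linarith
  have hc₃ : 1 / 2 ≤ c := by linarith
  have hRq : (R + 1) / q ≤ (R + 1) / √q := by gcongr
  have hE1 : |sudlerExponent q β l ε| ≤ 1 := by
    refine hE.trans ?_
    rw [div_le_one hsq0]
    exact Real.le_sqrt_of_sq_le hqK
  have hexp := Real.abs_exp_sub_one_le hE1
  have hdiff : |Real.exp (sudlerExponent q β l ε) - c| ≤ (2 * K + 2 * (R + 1)) / √q := by
    have h1 : 2 * |sudlerExponent q β l ε| ≤ 2 * (K / √q) := by linarith
    have h2 : (2 * K + 2 * (R + 1)) / √q = 2 * (K / √q) + 2 * ((R + 1) / √q) := by ring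
    rw [h2]
    rw [abs_le] at hexp ⊢
    have h3 : 0 ≤ (R + 1) / √q := by positivity
    constructor <;> linarith [hexp.1, hexp.2]
  have hfin : c * |reindexedSudler q β l ε - rationalMainTerm q β l ε| =
      rationalMainTerm q β l ε * |Real.exp (sudlerExponent q β l ε) - c| := by
    conv_lhs => rw [← abs_of_nonneg (by linarith : 0 ≤ c)]
    conv_rhs => rw [← abs_of_nonneg hH₀]
    rw [← abs_mul, ← abs_mul, mul_sub, mul_comm c, hid]
    congr 1
    ring
  have hle : rationalMainTerm q β l ε * |Real.exp (sudlerExponent q β l ε) - c| ≤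
      B * ((2 * K + 2 * (R + 1)) / √q) := mul_le_mul hH hdiff (abs_nonneg _) (hH₀.trans hH)
  rw [← hfin] at hle
  have h4 : 1 / 2 * |reindexedSudler q β l ε - rationalMainTerm q β l ε| ≤
      c * |reindexedSudler q β l ε - rationalMainTerm q β l ε| := by gcongr
  have h5 : 2 * (B * (2 * K + 2 * (R + 1))) / √q = 2 * (B * ((2 * K + 2 * (R + 1)) / √q)) := by ring
  rw [h5]
  linarith

/-- The numerator `p_k` of the `k`-th convergent of `α`. -/
noncomputable def pnum (α : ℝ) : ℕ → ℕ
  | 0 => 0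
  | 1 => 1
  | (k + 2) => pq α (k + 2) * pnum α (k + 1) + pnum α k

lemma gaussMap_iterate_mem {α : ℝ} (h0 : 0 < α) (h1 : α < 1) (hirr : Irrational α) (k : ℕ) :
    0 < gaussMap^[k] α ∧ gaussMap^[k] α < 1 ∧ Irrational (gaussMap^[k] α) := by
  induction k with
  | zero => exact ⟨h0, h1, hirr⟩
  | succ k ih =>
    have hi : Irrational (gaussMap^[k + 1] α) := by
      rw [Function.iterate_succ_apply', gaussMap, ← Int.self_sub_floor]
      exact ih.2.2.inv.sub_intCast _
    refine ⟨?_, ?_, hi⟩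
    · refine lt_of_le_of_ne ?_ (hi.ne_zero).symm
      rw [Function.iterate_succ_apply', gaussMap]
      exact Int.fract_nonneg _
    · rw [Function.iterate_succ_apply', gaussMap]
      exact Int.fract_lt_one _

lemma inv_gaussMap_iterate {α : ℝ} (h0 : 0 < α) (h1 : α < 1) (hirr : Irrational α) (k : ℕ) :
    (gaussMap^[k] α)⁻¹ = pq α (k + 1) + gaussMap^[k + 1] α := by
  have hpos := (gaussMap_iterate_mem h0 h1 hirr k).1
  rw [Function.iterate_succ_apply', gaussMap, pq, Nat.add_sub_cancel,
    natCast_floor_eq_intCast_floor (by positivity), Int.floor_add_fract]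

lemma one_le_pq {α : ℝ} (h0 : 0 < α) (h1 : α < 1) (hirr : Irrational α) (k : ℕ) :
    1 ≤ pq α (k + 1) := by
  obtain ⟨hpos, hlt, -⟩ := gaussMap_iterate_mem h0 h1 hirr k
  rw [pq, Nat.add_sub_cancel, Nat.one_le_floor_iff]
  exact (one_le_inv₀ hpos).mpr hlt.le

lemma qden_pos {α : ℝ} (h0 : 0 < α) (h1 : α < 1) (hirr : Irrational α) :
    ∀ k, 0 < qden α k
  | 0 => Nat.one_pos
  | 1 => one_le_pq h0 h1 hirr 0
  | (k + 2) => Nat.add_pos_right _ (qden_pos h0 h1 hirr k)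

lemma qden_add_le {α : ℝ} (h0 : 0 < α) (h1 : α < 1) (hirr : Irrational α) (k : ℕ) :
    qden α (k + 1) + qden α k ≤ qden α (k + 2) := by
  rw [qden]
  exact Nat.add_le_add_right (Nat.le_mul_of_pos_left _ (one_le_pq h0 h1 hirr (k + 1))) _

lemma qden_le_succ {α : ℝ} (h0 : 0 < α) (h1 : α < 1) (hirr : Irrational α) (k : ℕ) :
    qden α k ≤ qden α (k + 1) := by
  cases k with
  | zero => exact one_le_pq h0 h1 hirr 0
  | succ k => exact (Nat.le_add_right _ _).trans (qden_add_le h0 h1 hirr k)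

lemma le_qden {α : ℝ} (h0 : 0 < α) (h1 : α < 1) (hirr : Irrational α) (k : ℕ) :
    k ≤ qden α k := by
  have h : ∀ k, k + 1 ≤ qden α (k + 1) := fun k => by
    induction k with
    | zero => exact one_le_pq h0 h1 hirr 0
    | succ k ih =>
      have := qden_add_le h0 h1 hirr k
      have := qden_pos h0 h1 hirr k
      rw [show k + 1 + 1 = k + 2 from rfl]
      omega
  cases k with
  | zero => exact Nat.zero_le _
  | succ k => exact h k

lemma qden_succ_le {α : ℝ} (h0 : 0 < α) (h1 : α < 1) (hirr : Irrational α) {B : ℕ}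
    (hB : ∀ i : ℕ, 1 ≤ i → pq α i ≤ B) (k : ℕ) : qden α (k + 1) ≤ (B + 1) * qden α k := by
  cases k with
  | zero =>
    have := hB 1 le_rfl
    simp only [qden]
    omega
  | succ k =>
    rw [qden, add_mul, one_mul]
    exact add_le_add (Nat.mul_le_mul_right _ (hB _ (by omega))) (qden_le_succ h0 h1 hirr k)

lemma qden_mul_pnum_sub (α : ℝ) (k : ℕ) :
    (qden α (k + 1) : ℤ) * pnum α k - qden α k * pnum α (k + 1) = (-1) ^ (k + 1) := by
  induction k with
  | zero => simp [qden, pnum]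
  | succ k ih =>
    rw [qden, pnum, pow_succ, ← ih]
    push_cast
    ring

lemma isCoprime_pnum_qden (α : ℝ) (k : ℕ) : IsCoprime (pnum α k : ℤ) (qden α k) := by
  refine ⟨(-1) ^ (k + 1) * qden α (k + 1), -((-1) ^ (k + 1) * pnum α (k + 1)), ?_⟩
  have h := qden_mul_pnum_sub α k
  have h2 : ((-1 : ℤ) ^ (k + 1)) * (-1) ^ (k + 1) = 1 := by
    rw [← mul_pow]
    norm_num
  linear_combination (-1) ^ (k + 1) * h + h2

lemma isCoprime_qden_succ (α : ℝ) (k : ℕ) : IsCoprime (qden α k : ℤ) (qden α (k + 1)) := by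
  refine ⟨-((-1) ^ (k + 1) * pnum α (k + 1)), (-1) ^ (k + 1) * pnum α k, ?_⟩
  have h := qden_mul_pnum_sub α k
  have h2 : ((-1 : ℤ) ^ (k + 1)) * (-1) ^ (k + 1) = 1 := by
    rw [← mul_pow]
    norm_num
  linear_combination (-1) ^ (k + 1) * h + h2

/-- The signed error `(-1)^k (q_k α - p_k)`, which is positive. -/
noncomputable def convError (α : ℝ) (k : ℕ) : ℝ := (-1) ^ k * (qden α k * α - pnum α k)

lemma convError_succ {α : ℝ} (h0 : 0 < α) (h1 : α < 1) (hirr : Irrational α) (k : ℕ) :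
    convError α (k + 1) = gaussMap^[k + 1] α * convError α k := by
  induction k with
  | zero =>
    have h := inv_gaussMap_iterate h0 h1 hirr 0
    simp only [convError, qden, pnum, Function.iterate_zero, id] at h ⊢
    have h2 : gaussMap^[0 + 1] α = α⁻¹ - pq α (0 + 1) := by rw [h]; ring
    rw [h2]
    field_simp
    push_cast
    ring
  | succ k ih =>
    have h := inv_gaussMap_iterate h0 h1 hirr (k + 1)
    have hpos := (gaussMap_iterate_mem h0 h1 hirr (k + 1)).1
    have h2 : gaussMap^[k + 1 + 1] α = (gaussMap^[k + 1] α)⁻¹ - pq α (k + 1 + 1) := by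
      rw [h]; ring
    have h3 : convError α k = (gaussMap^[k + 1] α)⁻¹ * convError α (k + 1) := by
      rw [ih]
      field_simp
    have h4 : convError α (k + 2) = convError α k - pq α (k + 2) * convError α (k + 1) := by
      simp only [convError, qden, pnum]
      push_cast
      ring
    rw [h4, h3, h2]
    ring

lemma convError_pos {α : ℝ} (h0 : 0 < α) (h1 : α < 1) (hirr : Irrational α) (k : ℕ) :
    0 < convError α k := by
  induction k with
  | zero => simpa [convError, qden, pnum] using h0
  | succ k ih =>
    rw [convError_succ h0 h1 hirr]
    exact mul_pos (gaussMap_iterate_mem h0 h1 hirr _).1 ih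

lemma qden_mul_convError_add (α : ℝ) (k : ℕ) :
    qden α (k + 1) * convError α k + qden α k * convError α (k + 1) = 1 := by
  have h : (qden α (k + 1) : ℝ) * pnum α k - qden α k * pnum α (k + 1) = (-1) ^ (k + 1) := by
    exact_mod_cast qden_mul_pnum_sub α k
  have h2 : ((-1 : ℝ) ^ k) * (-1) ^ k = 1 := by
    rw [← mul_pow]
    norm_num
  rw [pow_succ] at h
  simp only [convError, pow_succ]
  linear_combination -(-1) ^ k * h + h2

lemma qden_succ_mul_convError_lt {α : ℝ} (h0 : 0 < α) (h1 : α < 1) (hirr : Irrational α) (k : ℕ) :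
    qden α (k + 1) * convError α k < 1 := by
  have h := qden_mul_convError_add α k
  have h2 : 0 < (qden α k : ℝ) := by exact_mod_cast qden_pos h0 h1 hirr k
  have h3 := mul_pos h2 (convError_pos h0 h1 hirr (k + 1))
  linarith

lemma qden_mul_convError_lt {α : ℝ} (h0 : 0 < α) (h1 : α < 1) (hirr : Irrational α) (k : ℕ) :
    qden α k * convError α k < 1 := by
  refine lt_of_le_of_lt ?_ (qden_succ_mul_convError_lt h0 h1 hirr k)
  have := convError_pos h0 h1 hirr k
  gcongr
  exact qden_le_succ h0 h1 hirr k

lemma qden_mul_eq (α : ℝ) (k : ℕ) :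
    qden α k * α = pnum α k + (-1) ^ k * convError α k := by
  have h2 : ((-1 : ℝ) ^ k) * (-1) ^ k = 1 := by
    rw [← mul_pow]
    norm_num
  rw [convError, ← mul_assoc, h2]
  ring

lemma dlt_eq_convError {α : ℝ} (h0 : 0 < α) (h1 : α < 1) (hirr : Irrational α) {k : ℕ}
    (hk : 1 ≤ k) : dlt α k = convError α k := by
  have hpos := convError_pos h0 h1 hirr k
  have hlt : convError α k < 1 / 2 := by
    have h := qden_succ_mul_convError_lt h0 h1 hirr k
    have h2 : (2 : ℝ) ≤ qden α (k + 1) := by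
      exact_mod_cast (by omega : 2 ≤ k + 1).trans (le_qden h0 h1 hirr (k + 1))
    nlinarith
  have habs : |(-1 : ℝ) ^ k * convError α k| = convError α k := by
    rw [abs_mul, abs_pow, abs_neg, abs_one, one_pow, one_mul, abs_of_pos hpos]
  have hround : round ((-1 : ℝ) ^ k * convError α k) = 0 := by
    rw [round_eq_zero_iff]
    obtain ⟨h3, h4⟩ := abs_lt.mp (habs.trans_lt hlt)
    constructor <;> linarith
  rw [dlt, nint, qden_mul_eq, round_natCast_add, hround]
  simpa using habs

lemma exists_le_mul_abs_mul_sub {α : ℝ} (h0 : 0 < α) (h1 : α < 1) (hirr : Irrational α) {B : ℕ}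
    (hB : ∀ i : ℕ, 1 ≤ i → pq α i ≤ B) {j : ℕ} (hj : 1 ≤ j) (m : ℤ) :
    1 / (4 * (B + 1 : ℝ)) ≤ j * |j * α - m| := by
  have hex : ∃ k, 2 * j < qden α k :=
    ⟨2 * j + 1, (Nat.lt_succ_self _).trans_le (le_qden h0 h1 hirr _)⟩
  classical
  obtain ⟨k, hk⟩ : ∃ k, Nat.find hex = k + 1 := by
    refine Nat.exists_eq_succ_of_ne_zero fun h => ?_
    have := Nat.find_spec hex
    rw [h] at this
    simp only [qden] at this
    omega
  have hlt : 2 * j < qden α (k + 1) := hk ▸ Nat.find_spec hex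
  have hle : qden α k ≤ 2 * j := by
    have := Nat.find_min hex (m := k) (by omega)
    omega
  have hQB : (qden α (k + 1) : ℝ) ≤ (B + 1) * (2 * j) := by
    exact_mod_cast (qden_succ_le h0 h1 hirr hB k).trans (Nat.mul_le_mul_left _ hle)
  have hint : (1 : ℝ) ≤ |(j : ℝ) * pnum α (k + 1) - m * qden α (k + 1)| := by
    have hne : (j : ℤ) * pnum α (k + 1) - m * qden α (k + 1) ≠ 0 := by
      intro h
      have hdvd : (qden α (k + 1) : ℤ) ∣ j * pnum α (k + 1) := ⟨m, by linarith⟩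
      have := (isCoprime_pnum_qden α (k + 1)).symm.dvd_of_dvd_mul_right hdvd
      have := Nat.le_of_dvd (by omega) (Int.natCast_dvd_natCast.mp this)
      omega
    exact_mod_cast Int.one_le_abs hne
  have hconv := qden_mul_convError_lt h0 h1 hirr (k + 1)
  have hcpos := convError_pos h0 h1 hirr (k + 1)
  have hqe := qden_mul_eq α (k + 1)
  set Q : ℝ := ((qden α (k + 1) : ℕ) : ℝ)
  set E := convError α (k + 1)
  have hj' : (1 : ℝ) ≤ j := by exact_mod_cast hj
  have hQj : 2 * (j : ℝ) < Q := by simp only [Q]; exact_mod_cast hlt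
  have hQ0 : 0 < Q := by linarith
  have hjE : j * E ≤ 1 / 2 := by nlinarith
  have hdec : Q * (j * α - m) =
      (j * pnum α (k + 1) - m * Q) + (-1) ^ (k + 1) * (j * E) := by
    linear_combination j * hqe
  have hlow : 1 / 2 ≤ Q * |j * α - m| := by
    rw [← abs_of_pos hQ0, ← abs_mul, hdec]
    have habs : |(-1 : ℝ) ^ (k + 1) * (j * E)| = j * E := by
      rw [abs_mul, abs_pow, abs_neg, abs_one, one_pow, one_mul, abs_of_nonneg (by positivity)]
    have := abs_sub_abs_le_abs_add (j * (pnum α (k + 1) : ℝ) - m * Q) ((-1) ^ (k + 1) * (j * E))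
    linarith
  have hB0 : (0 : ℝ) < B + 1 := by positivity
  rw [div_le_iff₀ (by positivity)]
  have := mul_le_mul_of_nonneg_right hQB (abs_nonneg (j * α - m))
  linarith

lemma le_mul_abs_mul_convergent_sub {α : ℝ} (h0 : 0 < α) (h1 : α < 1) (hirr : Irrational α)
    {c : ℝ} (hc₀ : 0 < c) (hc₁ : c ≤ 1)
    (hα : ∀ j : ℕ, 1 ≤ j → ∀ m : ℤ, c ≤ j * |j * α - m|) {k j : ℕ} (hj : 1 ≤ j)
    (hjq : j < qden α k) (m : ℤ) :
    c / 2 ≤ j * |j * ((pnum α k : ℝ) / qden α k) - m| := by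
  have hconv := qden_mul_convError_lt h0 h1 hirr k
  have hcpos := convError_pos h0 h1 hirr k
  have hqe := qden_mul_eq α k
  have hne : (j : ℤ) * pnum α k - m * qden α k ≠ 0 := by
    intro h
    have hdvd : (qden α k : ℤ) ∣ j * pnum α k := ⟨m, by linarith⟩
    have := (isCoprime_pnum_qden α k).symm.dvd_of_dvd_mul_right hdvd
    have := Nat.le_of_dvd (by omega) (Int.natCast_dvd_natCast.mp this)
    omega
  have hint : (1 : ℝ) ≤ |(j : ℝ) * pnum α k - m * qden α k| := by
    exact_mod_cast Int.one_le_abs hne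
  have hj' : (1 : ℝ) ≤ j := by exact_mod_cast hj
  have hq0 : (0 : ℝ) < qden α k := by exact_mod_cast (by omega : 0 < qden α k)
  set Q : ℝ := ((qden α k : ℕ) : ℝ)
  set E := convError α k
  have hX : j * ((pnum α k : ℝ) / Q) - m = (j * pnum α k - m * Q) / Q := by
    field_simp
  have hlow : 1 / Q ≤ |j * ((pnum α k : ℝ) / Q) - m| := by
    rw [hX, abs_div, abs_of_pos hq0]
    gcongr
  rcases le_or_gt (c / 2) (j / Q) with h | h
  · calc c / 2 ≤ j / Q := h
      _ = j * (1 / Q) := by ring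
      _ ≤ _ := by gcongr
  · have h2 := hα j hj m
    have h3 : |j * α - m| ≤ |j * ((pnum α k : ℝ) / Q) - m| + j * (E / Q) := by
      have h4 : j * α - m = (j * ((pnum α k : ℝ) / Q) - m) + (-1) ^ k * (j * (E / Q)) := by
        field_simp
        linear_combination j * hqe
      rw [h4]
      refine (abs_add_le _ _).trans (add_le_add le_rfl (le_of_eq ?_))
      rw [abs_mul, abs_pow, abs_neg, abs_one, one_pow, one_mul, abs_of_nonneg (by positivity)]
    have h5 : E ≤ 1 / Q := by
      rw [le_div_iff₀ hq0]
      linarith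
    have h6 : (j : ℝ) * (j * (E / Q)) ≤ c / 2 := by
      calc (j : ℝ) * (j * (E / Q)) ≤ j * (j * (1 / Q / Q)) := by gcongr
        _ = (j / Q) * (j / Q) := by ring
        _ ≤ c / 2 * (c / 2) := by gcongr
        _ ≤ c / 2 := by nlinarith
    have h7 : (j : ℝ) * |j * α - m| ≤
        j * (|j * ((pnum α k : ℝ) / Q) - m| + j * (E / Q)) := by gcongr
    linarith

lemma le_mul_abs_mul_reverse_sub {α : ℝ} {c : ℝ} {k : ℕ} (hc : c ≤ 1)
    (hp : ∀ j : ℕ, 1 ≤ j → j < qden α (k + 1) → ∀ m : ℤ,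
      c ≤ j * |j * ((pnum α (k + 1) : ℝ) / qden α (k + 1)) - m|)
    {s : ℕ} (hs : 1 ≤ s) (hsq : s < qden α (k + 1)) (m : ℤ) :
    c ≤ s * |s * ((qden α k : ℝ) / qden α (k + 1)) - m| := by
  set q := qden α (k + 1) with hq
  have hq0 : (0 : ℝ) < q := by exact_mod_cast (by omega : 0 < q)
  have hs' : (1 : ℝ) ≤ s := by exact_mod_cast hs
  obtain ⟨J, hJ⟩ : ∃ J : ℤ, J = s * qden α k - m * q := ⟨_, rfl⟩
  have hJ0 : J ≠ 0 := by
    intro h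
    rw [hJ] at h
    have hdvd : (q : ℤ) ∣ s * qden α k := ⟨m, by linarith⟩
    have := (isCoprime_qden_succ α k).symm.dvd_of_dvd_mul_right hdvd
    have := Nat.le_of_dvd (by omega) (Int.natCast_dvd_natCast.mp this)
    omega
  have hJR : (J : ℝ) = s * qden α k - m * q := by exact_mod_cast hJ
  have hX : |s * ((qden α k : ℝ) / q) - m| = |(J : ℝ)| / q := by
    rw [← abs_of_pos hq0, ← abs_div, abs_of_pos hq0, hJR]
    congr 1
    field_simp
  rw [hX]
  have hnat : ((J.natAbs : ℕ) : ℝ) = |(J : ℝ)| := by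
    rw [Nat.cast_natAbs, Int.cast_abs]
  rcases le_or_gt q J.natAbs with h | h
  · have h2 : (q : ℝ) ≤ |(J : ℝ)| := by rw [← hnat]; exact_mod_cast h
    have h3 : 1 ≤ |(J : ℝ)| / q := by rwa [one_le_div hq0]
    nlinarith
  · have hdet : (q : ℝ) * pnum α k - qden α k * pnum α (k + 1) = (-1) ^ (k + 1) := by
      exact_mod_cast qden_mul_pnum_sub α k
    have hval : J * ((pnum α (k + 1) : ℝ) / q) - ((s * pnum α k - m * pnum α (k + 1) : ℤ) : ℝ) =
        -((-1) ^ (k + 1) * (s / q)) := by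
      rw [hJR]
      push_cast
      field_simp
      linear_combination -(s : ℝ) * hdet
    have habs : |J * ((pnum α (k + 1) : ℝ) / q) -
        ((s * pnum α k - m * pnum α (k + 1) : ℤ) : ℝ)| = s / q := by
      rw [hval, abs_neg, abs_mul, abs_pow, abs_neg, abs_one, one_pow, one_mul,
        abs_of_nonneg (by positivity)]
    have hgoal : c ≤ |(J : ℝ)| * (s / q) := by
      rcases Int.natAbs_eq J with hJ' | hJ'
      · have h2 := hp J.natAbs (by omega) h (s * pnum α k - m * pnum α (k + 1))
        have h3 : ((J.natAbs : ℕ) : ℝ) = J := by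
          rw [hnat, abs_of_nonneg (by exact_mod_cast (by omega : 0 ≤ J))]
        rw [h3, habs, ← h3, hnat] at h2
        exact h2
      · have h2 := hp J.natAbs (by omega) h (-(s * pnum α k - m * pnum α (k + 1)))
        have h3 : |(J : ℝ)| = -J := abs_of_nonpos (by exact_mod_cast (by omega : J ≤ 0))
        rw [hnat] at h2
        have h4 : |(J : ℝ)| * ((pnum α (k + 1) : ℝ) / q) -
            ((-(s * pnum α k - m * pnum α (k + 1)) : ℤ) : ℝ) =
            -(J * ((pnum α (k + 1) : ℝ) / q) -
              ((s * pnum α k - m * pnum α (k + 1) : ℤ) : ℝ)) := by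
          rw [h3]
          push_cast
          ring
        rwa [h4, abs_neg, habs] at h2
    calc c ≤ |(J : ℝ)| * (s / q) := hgoal
      _ = s * (|(J : ℝ)| / q) := by ring

lemma abs_sin_pi_mul_int_add (z : ℤ) (k : ℕ) (y : ℝ) :
    |Real.sin (Real.pi * (z + (-1) ^ k * y))| = |Real.sin (Real.pi * y)| := by
  have h : Real.pi * (z + (-1) ^ k * y) = (-1) ^ k * (Real.pi * y) + z * Real.pi := by ring
  rw [h, Real.sin_add_int_mul_pi, abs_mul, abs_neg_one_zpow, one_mul]
  rcases neg_one_pow_eq_or ℝ k with h | h <;> rw [h] <;> simp [Real.sin_neg]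

lemma sudlerPert_eq_reindexedSudler {α : ℝ} (h0 : 0 < α) (h1 : α < 1) (hirr : Irrational α)
    (k : ℕ) (ε : ℝ) :
    sudlerPert α (k + 1) ε = reindexedSudler (qden α (k + 1))
      ((qden α k : ℝ) / qden α (k + 1)) (qden α (k + 1) * convError α (k + 1)) ε := by
  set q := qden α (k + 1) with hq
  have hqpos : 0 < q := qden_pos h0 h1 hirr (k + 1)
  have hq0 : (0 : ℝ) < q := by exact_mod_cast hqpos
  have hmaps : Set.MapsTo (fun n : ℕ => q - n * qden α k % q)
      (Finset.range q) (Finset.Icc 1 q) := fun n _ => by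
    have := Nat.mod_lt (n * qden α k) hqpos
    simp only [Finset.coe_Icc, Set.mem_Icc]
    omega
  have hinj : Set.InjOn (fun n : ℕ => q - n * qden α k % q) (Finset.range q) := by
    intro i hi j hj hij
    simp only [Finset.coe_range, Set.mem_Iio] at hi hj hij
    have h1 := Nat.mod_lt (i * qden α k) hqpos
    have h2 := Nat.mod_lt (j * qden α k) hqpos
    have h3 : i * qden α k ≡ j * qden α k [MOD q] := by
      unfold Nat.ModEq
      omega
    have hcop : Nat.gcd q (qden α k) = 1 :=
      Nat.isCoprime_iff_coprime.mp (isCoprime_qden_succ α k).symm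
    have h4 := Nat.ModEq.cancel_right_of_coprime hcop h3
    exact Nat.ModEq.eq_of_lt_of_lt h4 hi hj
  have hdet : (q : ℝ) * pnum α k - qden α k * pnum α (k + 1) = (-1) ^ (k + 1) := by
    exact_mod_cast qden_mul_pnum_sub α k
  have hqe := qden_mul_eq α (k + 1)
  rw [← hq] at hqe
  rw [sudlerPert, reindexedSudler]
  refine (Finset.prod_nbij (fun n : ℕ => q - n * qden α k % q) (fun n hn => hmaps hn) hinj
    (Finset.surjOn_of_injOn_of_card_le _ hmaps hinj (by simp)) fun n _ => ?_).symm
  have hmod := Nat.mod_lt (n * qden α k) hqpos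
  have hfr : Int.fract ((n : ℝ) * ((qden α k : ℝ) / q)) = ((n * qden α k % q : ℕ) : ℝ) / q := by
    rw [← mul_div_assoc, ← Nat.cast_mul]
    exact Int.fract_div_natCast_eq_div_natCast_mod
  have hdiv : (n : ℝ) * qden α k =
      q * ((n * qden α k / q : ℕ) : ℝ) + ((n * qden α k % q : ℕ) : ℝ) := by
    exact_mod_cast (Nat.div_add_mod (n * qden α k) q).symm
  rw [hfr, ← hq, Nat.cast_sub hmod.le]
  set d : ℕ := n * qden α k / q
  set m : ℕ := n * qden α k % q
  set E := convError α (k + 1)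
  rw [← abs_sin_pi_mul_int_add (pnum α (k + 1) + d * pnum α (k + 1) - n * pnum α k) (k + 1)]
  congr 4
  have hα : α = (pnum α (k + 1) + (-1) ^ (k + 1) * E) / q := by
    rw [← hqe]
    field_simp
  have hm : (m : ℝ) = n * qden α k - q * d := by linarith
  push_cast
  generalize pnum α (k + 1) = P at hα hdet ⊢
  generalize pnum α k = P' at hdet ⊢
  rw [hα]
  field_simp
  rw [hm]
  linear_combination (-(n : ℝ)) * hdet

lemma prod_Icc_one_eq_prod_range (f : ℕ → ℝ) (m : ℕ) :
    ∏ n ∈ Finset.Icc 1 m, f n = ∏ i ∈ Finset.range m, f (i + 1) := by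
  induction m with
  | zero => simp
  | succ m ih => rw [Finset.prod_Icc_succ_top (by omega), ih, Finset.prod_range_succ]

lemma HkF_eq_rationalMainTerm {α : ℝ} (h0 : 0 < α) (h1 : α < 1) (hirr : Irrational α)
    (k : ℕ) (ε : ℝ) :
    HkF α (k + 1) ε = rationalMainTerm (qden α (k + 1))
      ((qden α k : ℝ) / qden α (k + 1)) (qden α (k + 1) * convError α (k + 1)) ε := by
  rw [HkF, rationalMainTerm, prod_Icc_one_eq_prod_range,
    dlt_eq_convError h0 h1 hirr (Nat.le_add_left 1 k)]
  simp only [hnk, dlt_eq_convError h0 h1 hirr (Nat.le_add_left 1 k), Nat.add_sub_cancel]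

/-- For badly approximable `α`, `|P_{q_k}(α,ε) - H_k(α,ε)| → 0` as `k → ∞`,
locally uniformly in `ε` (uniformly on every compact set). -/
theorem sudlerPert_sub_HkF_tendstoUniformlyOn
    (α : ℝ) (h0 : 0 < α) (h1 : α < 1) (hirr : Irrational α)
    (hbad : ∃ B : ℕ, ∀ i : ℕ, 1 ≤ i → pq α i ≤ B) :
    ∀ K : Set ℝ, IsCompact K →
      TendstoUniformlyOn (fun (k : ℕ) (ε : ℝ) => sudlerPert α k ε - HkF α k ε)
        (fun _ => 0) Filter.atTop K := by
  intro K hK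
  obtain ⟨B, hB⟩ := hbad
  set c : ℝ := 1 / (4 * (B + 1 : ℝ)) with hc
  have hc₀ : 0 < c := by positivity
  have hc₁ : c ≤ 1 := by
    rw [hc, div_le_one (by positivity)]
    linarith [(Nat.cast_nonneg B : (0 : ℝ) ≤ B)]
  have hrev : ∀ k s : ℕ, 1 ≤ s → s < qden α (k + 1) → ∀ m : ℤ,
      c / 2 ≤ s * |s * ((qden α k : ℝ) / qden α (k + 1)) - m| := fun k s hs hsq m =>
    le_mul_abs_mul_reverse_sub (by linarith)
      (fun j hj hjq m => le_mul_abs_mul_convergent_sub h0 h1 hirr hc₀ hc₁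
        (fun j hj m => exists_le_mul_abs_mul_sub h0 h1 hirr hB hj m) hj hjq m) hs hsq m
  obtain ⟨R, hR⟩ := hK.isBounded.exists_norm_le
  obtain ⟨D, Q, hDQ⟩ := exists_abs_reindexedSudler_sub_le (R := max R 0) (C := 8 / (c / 2) + 1)
    (le_max_right _ _) (by positivity)
  have hqtop : Filter.Tendsto (fun k => (qden α k : ℝ)) Filter.atTop Filter.atTop :=
    tendsto_natCast_atTop_atTop.comp
      (Filter.tendsto_atTop_mono (le_qden h0 h1 hirr) Filter.tendsto_id)
  have hlim : Filter.Tendsto (fun k => D / √(qden α k : ℝ)) Filter.atTop (nhds 0) :=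
    (Real.tendsto_sqrt_atTop.comp hqtop).const_div_atTop D
  rw [Metric.tendstoUniformlyOn_iff]
  intro η hη
  filter_upwards [hqtop.eventually_ge_atTop Q, hlim.eventually_lt_const hη,
    Filter.eventually_ge_atTop 1] with k hkQ hkη hk ε hε
  obtain ⟨k, rfl⟩ := Nat.exists_eq_succ_of_ne_zero (by omega : k ≠ 0)
  rw [Nat.succ_eq_add_one] at *
  rw [dist_zero_left, Real.norm_eq_abs, sudlerPert_eq_reindexedSudler h0 h1 hirr,
    HkF_eq_rationalMainTerm h0 h1 hirr]
  have hq0 : (0 : ℝ) < qden α (k + 1) := by exact_mod_cast qden_pos h0 h1 hirr (k + 1)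
  refine (hDQ _ _ _ _ (qden α k : ℤ) hkQ ?_ ?_ ?_ ?_ ?_ ?_).trans_lt hkη
  · push_cast
    field_simp
  · intro n hn hnq hfr
    have h := hrev k n hn hnq ⌊(n : ℝ) * ((qden α k : ℝ) / qden α (k + 1))⌋
    rw [Int.self_sub_floor, hfr, abs_zero, mul_zero] at h
    linarith
  · intro j hj
    have h := abs_sum_fract_le_sqrt (half_pos hc₀) (hrev k) hj
      ((qden α k : ℝ) / qden α (k + 1))
    refine le_trans (le_of_eq ?_) h
    congr 1
    refine Finset.sum_congr rfl fun i _ => ?_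
    congr 2
    push_cast
    ring
  · exact mul_nonneg hq0.le (convError_pos h0 h1 hirr _).le
  · exact (qden_mul_convError_lt h0 h1 hirr _).le
  · exact (hR ε hε).trans (le_max_left _ _)
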